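/- arXiv:1603.00783 — 2 statements merged into one kernel-verified Lean document; each statement's English description precedes it below -/
import Mathlib

section
/- Let b ∈ (0, 1). There exists a constant C_b > 0 such that for every t > 0 and every x ≠ 0 with (t^{1/3} x²)^{−1} ≤ t^{1/3}|x| (equivalently |x|³ t^{2/3} ≥ 1), one has ( ∫_ℝ |e^{i(−3x²t^{2/3}w + 3x t^{1/3} w² − w³)} − 1|² / |w|^{1+2b} dw )^{1/2} ≤ C_b [ t^{1/3 − b/9} + ( t^{1/3 + b/3} + t^{b/3} ) |x|^{2b} ]. -/
open MeasureTheory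

/-- The phase `−3x²t^{2/3}w + 3xt^{1/3}w² − w³` arising from the change of variables
`w = t^{1/3}(x − y)` in the Stein derivative of `y ↦ e^{ity³}`. -/
noncomputable def cubicPhase (t x w : ℝ) : ℝ :=
  -3 * x ^ 2 * t ^ ((2 : ℝ) / 3) * w + 3 * x * t ^ ((1 : ℝ) / 3) * w ^ 2 - w ^ 3

/-- The scale-invariant majorant of the cubic-phase integrand. -/
noncomputable def phaseMajorant (b u : ℝ) : ℝ :=
  min (49 * u ^ 2) 4 / |u| ^ (1 + 2 * b)

lemma phaseMajorant_nonneg (b u : ℝ) : 0 ≤ phaseMajorant b u := by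
  unfold phaseMajorant
  positivity

lemma phaseMajorant_neg (b u : ℝ) : phaseMajorant b (-u) = phaseMajorant b u := by
  simp [phaseMajorant]

lemma measurable_phaseMajorant (b : ℝ) : Measurable (phaseMajorant b) := by
  unfold phaseMajorant
  fun_prop

lemma integrableOn_Ioi_phaseMajorant {b : ℝ} (hb : b ∈ Set.Ioo (0 : ℝ) 1) :
    IntegrableOn (phaseMajorant b) (Set.Ioi 0) := by
  obtain ⟨hb0, hb1⟩ := hb
  rw [← Set.Ioc_union_Ioi_eq_Ioi zero_le_one]
  refine IntegrableOn.union ?_ ?_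
  · have hdom : IntegrableOn (fun u : ℝ => 49 * u ^ (1 - 2 * b)) (Set.Ioc 0 1) :=
      ((intervalIntegrable_iff_integrableOn_Ioc_of_le zero_le_one).1
        (intervalIntegral.intervalIntegrable_rpow' (by linarith))).const_mul 49
    refine Integrable.mono' hdom (measurable_phaseMajorant b).aestronglyMeasurable ?_
    filter_upwards [ae_restrict_mem measurableSet_Ioc] with u hu
    have hu0 : 0 < u := hu.1
    rw [Real.norm_of_nonneg (phaseMajorant_nonneg b u), phaseMajorant, abs_of_pos hu0,
      div_le_iff₀ (by positivity), mul_assoc, ← Real.rpow_add hu0]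
    ring_nf
    rw [Real.rpow_ofNat]
    exact (min_le_left _ _)
  · have hdom : IntegrableOn (fun u : ℝ => 4 * u ^ (-(1 + 2 * b))) (Set.Ioi 1) :=
      (integrableOn_Ioi_rpow_of_lt (by linarith) zero_lt_one).const_mul 4
    refine Integrable.mono' hdom (measurable_phaseMajorant b).aestronglyMeasurable ?_
    filter_upwards [ae_restrict_mem measurableSet_Ioi] with u hu
    have hu0 : 0 < u := zero_lt_one.trans hu
    rw [Real.norm_of_nonneg (phaseMajorant_nonneg b u), phaseMajorant, abs_of_pos hu0,
      Real.rpow_neg hu0.le, ← div_eq_mul_inv]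
    gcongr
    exact min_le_right _ _

lemma integrable_phaseMajorant {b : ℝ} (hb : b ∈ Set.Ioo (0 : ℝ) 1) :
    Integrable (phaseMajorant b) := by
  have h := integrableOn_Ioi_phaseMajorant hb
  have hneg : IntegrableOn (phaseMajorant b) (Set.Iic 0) := by
    rw [integrableOn_Iic_iff_integrableOn_Iio]
    rw [← neg_zero] at h
    exact h.comp_neg_Iio.congr_fun (fun u _ => phaseMajorant_neg b u) measurableSet_Iio
  rw [← integrableOn_univ, ← Set.Iic_union_Ioi (a := (0 : ℝ))]
  exact hneg.union h

/-- The cubic phase is at most `7 M² |w|` at scales `M² |w| ≤ 1`, where `M` bounds both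
`1` and `t^{1/3} |x|`. -/
lemma abs_cubicPhase_le {t x w M : ℝ} (ht : 0 < t) (hM : 1 ≤ M)
    (haM : t ^ ((1 : ℝ) / 3) * |x| ≤ M) (hw : M ^ 2 * |w| ≤ 1) :
    |cubicPhase t x w| ≤ 7 * (M ^ 2 * |w|) := by
  have ht2 : t ^ ((2 : ℝ) / 3) = (t ^ ((1 : ℝ) / 3)) ^ 2 := by
    rw [← Real.rpow_natCast, ← Real.rpow_mul ht.le]; norm_num
  set s := t ^ ((1 : ℝ) / 3) with hs
  have hs0 : 0 < s := by positivity
  have hw0 := abs_nonneg w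
  have hw1 : |w| ≤ 1 :=
    (le_mul_of_one_le_left hw0 (one_le_pow₀ hM)).trans hw
  have hphase : |cubicPhase t x w| ≤
      3 * (s * |x|) ^ 2 * |w| + 3 * (s * |x|) * |w| ^ 2 + |w| ^ 3 := by
    rw [cubicPhase, ht2, ← hs]
    refine (abs_sub _ _).trans ?_
    refine (add_le_add_left (abs_add_le _ _) _).trans (le_of_eq ?_)
    simp only [abs_mul, abs_pow, abs_neg, abs_of_pos hs0, Nat.abs_ofNat]
    ring
  have ha0 : 0 ≤ s * |x| := by positivity
  have hM2 : M ≤ M ^ 2 := by nlinarith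
  have h1 : (s * |x|) ^ 2 * |w| ≤ M ^ 2 * |w| := by gcongr
  have h2 : (s * |x|) * |w| ^ 2 ≤ M ^ 2 * |w| :=
    mul_le_mul (haM.trans hM2) (by nlinarith) (by positivity) (by positivity)
  have h3 : |w| ^ 3 ≤ M ^ 2 * |w| := by
    calc |w| ^ 3 ≤ |w| := pow_le_of_le_one hw0 hw1 (by norm_num)
      _ ≤ M ^ 2 * |w| := le_mul_of_one_le_left hw0 (by nlinarith)
  linarith

lemma norm_exp_cubicPhase_sub_one_sq_le {t x M : ℝ} (w : ℝ) (ht : 0 < t) (hM : 1 ≤ M)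
    (haM : t ^ ((1 : ℝ) / 3) * |x| ≤ M) :
    ‖Complex.exp (Complex.I * ((cubicPhase t x w : ℝ) : ℂ)) - 1‖ ^ 2 ≤
      min (49 * (M ^ 2 * w) ^ 2) 4 := by
  have htwo : ‖Complex.exp (Complex.I * ((cubicPhase t x w : ℝ) : ℂ)) - 1‖ ^ 2 ≤ 4 := by
    have h : ‖Complex.exp (Complex.I * ((cubicPhase t x w : ℝ) : ℂ)) - 1‖ ≤ 2 := by
      refine (norm_sub_le _ _).trans ?_
      rw [Complex.norm_exp_I_mul_ofReal, norm_one]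
      norm_num
    nlinarith [norm_nonneg (Complex.exp (Complex.I * ((cubicPhase t x w : ℝ) : ℂ)) - 1)]
  refine le_min ?_ htwo
  have habs : (M ^ 2 * w) ^ 2 = (M ^ 2 * |w|) ^ 2 := by rw [mul_pow, mul_pow, sq_abs]
  rw [habs]
  rcases le_total (M ^ 2 * |w|) 1 with hw | hw
  · have h := (Real.norm_exp_I_mul_ofReal_sub_one_le (x := cubicPhase t x w)).trans
      (abs_cubicPhase_le ht hM haM hw)
    calc _ ≤ (7 * (M ^ 2 * |w|)) ^ 2 := by gcongr
      _ = _ := by ring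
  · nlinarith

/-- The integral in the Stein derivative grows at most like `M^{4b}`. -/
lemma integral_cubicPhase_le {b t x M : ℝ} (hb : b ∈ Set.Ioo (0 : ℝ) 1) (ht : 0 < t)
    (hM : 1 ≤ M) (haM : t ^ ((1 : ℝ) / 3) * |x| ≤ M) :
    (∫ w : ℝ, ‖Complex.exp (Complex.I * ((cubicPhase t x w : ℝ) : ℂ)) - 1‖ ^ 2 /
        |w| ^ (1 + 2 * b)) ≤ (M ^ (2 * b)) ^ 2 * ∫ u : ℝ, phaseMajorant b u := by
  have hM0 : 0 < M := zero_lt_one.trans_le hM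
  have hM2 : 0 < M ^ 2 := by positivity
  have hscale : (M ^ 2) ^ (1 + 2 * b) = M ^ 2 * (M ^ (2 * b)) ^ 2 := by
    rw [Real.rpow_add hM2, Real.rpow_one, ← Real.rpow_natCast, ← Real.rpow_natCast,
      ← Real.rpow_mul hM0.le, ← Real.rpow_mul hM0.le, mul_comm ((2 : ℕ) : ℝ)]
  calc _ ≤ ∫ w : ℝ, (M ^ 2) ^ (1 + 2 * b) * phaseMajorant b (M ^ 2 * w) := by
        refine integral_mono_of_nonneg (.of_forall fun w => by positivity)
          (((integrable_phaseMajorant hb).comp_mul_left' hM2.ne').const_mul _)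
          (.of_forall fun w => ?_)
        simp only [phaseMajorant]
        rw [abs_mul, abs_of_pos hM2, Real.mul_rpow hM2.le (abs_nonneg w), ← mul_div_assoc,
          mul_div_mul_left _ _ (by positivity)]
        gcongr
        exact norm_exp_cubicPhase_sub_one_sq_le w ht hM haM
    _ = (M ^ (2 * b)) ^ 2 * ∫ u : ℝ, phaseMajorant b u := by
        rw [integral_const_mul, Measure.integral_comp_mul_left, hscale,
          abs_of_pos (inv_pos.2 hM2), smul_eq_mul]
        field_simp

/-- In the regime `t^{2/3} |x|³ ≥ 1`, the scale `max 1 (t^{1/3} |x|)` is controlled by the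
part of the bound carrying `|x|^{2b}`. -/
lemma max_one_rpow_le {b t x : ℝ} (hb : b ∈ Set.Ioo (0 : ℝ) 1) (ht : 0 < t) (hx : x ≠ 0)
    (h : (t ^ ((1 : ℝ) / 3) * x ^ 2)⁻¹ ≤ t ^ ((1 : ℝ) / 3) * |x|) :
    (max 1 (t ^ ((1 : ℝ) / 3) * |x|)) ^ (2 * b) ≤
      (t ^ (1 / 3 + b / 3) + t ^ (b / 3)) * |x| ^ (2 * b) := by
  obtain ⟨hb0, hb1⟩ := hb
  have hX : 0 < |x| := abs_pos.2 hx
  have e1 : t ^ (b / 3) = (t ^ ((1 : ℝ) / 3)) ^ b := by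
    rw [← Real.rpow_mul ht.le]; ring_nf
  rw [Real.rpow_add ht, e1, ← sq_abs] at *
  set s := t ^ ((1 : ℝ) / 3)
  have hs : 0 < s := by positivity
  set X := |x|
  have hcond : 1 ≤ s ^ 2 * X ^ 3 := by
    rw [inv_le_iff_one_le_mul₀ (by positivity)] at h
    nlinarith
  have hsb : 0 < s ^ b := by positivity
  have hXb : 0 < X ^ (2 * b) := by positivity
  rcases le_total 1 (s * X) with ha | ha
  · have hs1 : s ^ b ≤ s + 1 := by
      rcases le_total 1 s with h1 | h1
      · have hle := Real.rpow_le_rpow_of_exponent_le h1 hb1.le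
        rw [Real.rpow_one] at hle
        linarith
      · linarith [Real.rpow_le_one hs.le h1 hb0.le]
    rw [max_eq_right ha, Real.mul_rpow hs.le hX.le, mul_comm 2 b, Real.rpow_mul hs.le,
      Real.rpow_ofNat]
    rw [mul_comm 2 b] at hXb
    nlinarith [mul_le_mul_of_nonneg_right hs1 (mul_pos hsb hXb).le]
  · rw [max_eq_left ha, Real.one_rpow]
    have hX1 : 1 ≤ X := by nlinarith [mul_pos hs hX, mul_le_mul ha ha (by positivity) zero_le_one]
    have hsX : 1 ≤ s * X ^ 2 := by
      calc 1 ≤ s ^ 2 * X ^ 3 := hcond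
        _ = (s * X) * (s * X ^ 2) := by ring
        _ ≤ 1 * (s * X ^ 2) := by gcongr
        _ = s * X ^ 2 := one_mul _
    have := Real.one_le_rpow hsX hb0.le
    rw [Real.mul_rpow hs.le (by positivity), ← Real.rpow_natCast, ← Real.rpow_mul hX.le] at this
    push_cast at this
    nlinarith [mul_pos hs (mul_pos hsb hXb)]

theorem cubic_phase_integral_full (b : ℝ) (hb : b ∈ Set.Ioo (0 : ℝ) 1) :
    ∃ C : ℝ, 0 < C ∧ ∀ t : ℝ, 0 < t → ∀ x : ℝ, x ≠ 0 →
      (t ^ ((1 : ℝ) / 3) * x ^ 2)⁻¹ ≤ t ^ ((1 : ℝ) / 3) * |x| →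
      (∫ w : ℝ,
          ‖Complex.exp (Complex.I * ((cubicPhase t x w : ℝ) : ℂ)) - 1‖ ^ 2 /
            |w| ^ (1 + 2 * b)) ^ ((1 : ℝ) / 2) ≤
        C * (t ^ (1 / 3 - b / 9) + (t ^ (1 / 3 + b / 3) + t ^ (b / 3)) * |x| ^ (2 * b)) := by
  have hK : 0 ≤ ∫ u : ℝ, phaseMajorant b u := integral_nonneg (phaseMajorant_nonneg b)
  refine ⟨√(∫ u : ℝ, phaseMajorant b u) + 1, by positivity, fun t ht x hx h => ?_⟩
  rw [← Real.sqrt_eq_rpow]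
  calc _ ≤ √(((max 1 (t ^ ((1 : ℝ) / 3) * |x|)) ^ (2 * b)) ^ 2 * ∫ u : ℝ, phaseMajorant b u) :=
        Real.sqrt_le_sqrt (integral_cubicPhase_le hb ht (le_max_left _ _) (le_max_right _ _))
    _ = √(∫ u : ℝ, phaseMajorant b u) * (max 1 (t ^ ((1 : ℝ) / 3) * |x|)) ^ (2 * b) := by
        rw [Real.sqrt_mul (by positivity), Real.sqrt_sq (by positivity), mul_comm]
    _ ≤ _ := by
        refine mul_le_mul (by linarith) ?_ (by positivity) (by positivity)
        exact (max_one_rpow_le hb ht hx h).trans (le_add_of_nonneg_left (by positivity))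
end

section
/- Let b ∈ (0, 1/2]. There exists a constant C_b > 0 such that for every x > 0 and every t with 0 < t/x ≤ 6π, setting f(w) := (t/x) · w/(w − x), one has ( ∫_{{w : w ≥ 3x/2}} |e^{i f(w)} − 1|² / |w|^{1+2b} dw )^{1/2} ≤ C_b t^b / x^{2b}. -/
open MeasureTheory

/-- The phase `f(w) = (t/x) · w/(w − x)` arising from the change of variables `w = x − y`
in the Stein derivative of `y ↦ e^{−it/y}`. -/
noncomputable def mobiusPhase (t x w : ℝ) : ℝ := t / x * (w / (w - x))

/-- Away from the pole the phase is at most three times its value at infinity. -/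
theorem abs_mobiusPhase_le {t x w : ℝ} (hx : 0 < x) (hs : 0 < t / x) (hw : 3 * x / 2 ≤ w) :
    |mobiusPhase t x w| ≤ 3 * (t / x) := by
  have hwx : 0 < w - x := by linarith
  have hq : w / (w - x) ≤ 3 := by
    rw [div_le_iff₀ hwx]
    linarith
  have hq0 : 0 ≤ w / (w - x) := div_nonneg (by linarith) hwx.le
  rw [mobiusPhase, abs_of_nonneg (mul_nonneg hs.le hq0), mul_comm 3]
  exact mul_le_mul_of_nonneg_left hq hs.le

theorem mobiusPhase_integral_le {b x t : ℝ} (hb : 0 < b) (hx : 0 < x) (hs : 0 < t / x) :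
    ∫ w in {w : ℝ | 3 * x / 2 ≤ w},
        ‖Complex.exp (Complex.I * ((mobiusPhase t x w : ℝ) : ℂ)) - 1‖ ^ 2 / |w| ^ (1 + 2 * b) ≤
      (3 * (t / x)) ^ 2 * (x ^ (-(2 * b)) / (2 * b)) := by
  have hx0 : 0 < 3 * x / 2 := by linarith
  have hexp : -(1 + 2 * b) < -1 := by linarith
  change ∫ w in Set.Ici (3 * x / 2), _ ≤ _
  calc
    _ ≤ ∫ w in Set.Ici (3 * x / 2), (3 * (t / x)) ^ 2 * w ^ (-(1 + 2 * b)) := by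
      refine integral_mono_of_nonneg (Filter.Eventually.of_forall fun w => by positivity) ?_ ?_
      · rw [← IntegrableOn, integrableOn_Ici_iff_integrableOn_Ioi]
        exact (integrableOn_Ioi_rpow_of_lt hexp hx0).const_mul _
      · refine (ae_restrict_iff' measurableSet_Ici).2 (Filter.Eventually.of_forall fun w hw => ?_)
        have hw0 : 0 < w := hx0.trans_le hw
        have hnorm : ‖Complex.exp (Complex.I * ((mobiusPhase t x w : ℝ) : ℂ)) - 1‖ ≤
            3 * (t / x) :=
          (Real.norm_exp_I_mul_ofReal_sub_one_le).trans (abs_mobiusPhase_le hx hs hw)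
        dsimp only
        rw [abs_of_pos hw0, Real.rpow_neg hw0.le, ← div_eq_mul_inv]
        gcongr
    _ = (3 * (t / x)) ^ 2 * ((3 * x / 2) ^ (-(2 * b)) / (2 * b)) := by
      rw [integral_Ici_eq_integral_Ioi, integral_const_mul, integral_Ioi_rpow_of_lt hexp hx0,
        show -(1 + 2 * b) + 1 = -(2 * b) by ring, neg_div_neg_eq]
    _ ≤ _ := by
      have hpow : (3 * x / 2) ^ (-(2 * b)) ≤ x ^ (-(2 * b)) :=
        Real.rpow_le_rpow_of_nonpos hx (by linarith) (by linarith)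
      gcongr

theorem mobius_phase_integral_E3 (b : ℝ) (hb : b ∈ Set.Ioc (0 : ℝ) (1 / 2)) :
    ∃ C : ℝ, 0 < C ∧ ∀ x : ℝ, 0 < x → ∀ t : ℝ, 0 < t / x → t / x ≤ 6 * Real.pi →
      (∫ w in {w : ℝ | 3 * x / 2 ≤ w},
          ‖Complex.exp (Complex.I * ((mobiusPhase t x w : ℝ) : ℂ)) - 1‖ ^ 2 /
            |w| ^ (1 + 2 * b)) ^ ((1 : ℝ) / 2) ≤ C * t ^ b / x ^ (2 * b) := by
  obtain ⟨hb0, hb2⟩ := hb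
  have hpi := Real.pi_pos
  refine ⟨3 * (6 * Real.pi) ^ (1 - b) / √(2 * b), by positivity, fun x hx t hs hle => ?_⟩
  have ht : 0 < t := (div_pos_iff_of_pos_right hx).1 hs
  have hsb : t / x ≤ (6 * Real.pi) ^ (1 - b) * (t / x) ^ b := by
    calc
      t / x = (t / x) ^ (1 - b) * (t / x) ^ b := by
        rw [← Real.rpow_add hs, sub_add_cancel, Real.rpow_one]
      _ ≤ _ := by
        gcongr
        linarith
  rw [← Real.sqrt_eq_rpow]
  refine Real.sqrt_le_iff.2 ⟨by positivity, (mobiusPhase_integral_le hb0 hx hs).trans ?_⟩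
  calc
    _ ≤ (3 * ((6 * Real.pi) ^ (1 - b) * (t / x) ^ b)) ^ 2 * (x ^ (-(2 * b)) / (2 * b)) := by
      gcongr
    _ = _ := by
      have hxb : x ^ (2 * b) = x ^ b * x ^ b := by rw [two_mul, Real.rpow_add hx]
      have hsq : √(2 * b) ^ 2 = 2 * b := Real.sq_sqrt (by positivity)
      rw [Real.div_rpow ht.le hx.le, Real.rpow_neg hx.le, hxb]
      simp only [div_pow, mul_pow, hsq]
      field_simp
end
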